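/- Let ı := ε^L(h g_L^{-2}) (a positive, invertible, S-invariant element of Hyp(A)), and define the linear functional ĵ ∈ A* by ⟨ĵ, x⟩ := ε(x ı). Then: (1) ⟨ĵ, x⟩ = ε(ı x) for all x ∈ A; (2) ı = ⟨ĵ, 1_{(1)}⟩ 1_{(2)} = ⟨ĵ, 1_{(2)}⟩ 1_{(1)}; (3) ĵ ∘ S = ĵ; (4) ⟨ĵ, x* x⟩ is a nonnegative real number for all x ∈ A; (5) ĵ is central for the convolution product of A*, i.e. ε(x_{(1)} ı) ⟨φ, x_{(2)}⟩ = ⟨φ, x_{(1)}⟩ ε(x_{(2)} ı) for all φ ∈ A* and x ∈ A; and (6) ĵ is invertible for the convolution product of A*, with inverse x ↦ ε(x ı^{-1}), i.e. ε(x_{(1)} ı) ε(x_{(2)} ı^{-1}) = ε(x) = ε(x_{(1)} ı^{-1}) ε(x_{(2)} ı) for all x ∈ A. -/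

import Mathlib

open scoped TensorProduct

noncomputable section

/-- An element of a `C*`-algebra is positive iff it is of the form `star y * y`. -/
def IsPosElem {A : Type*} [Mul A] [Star A] (x : A) : Prop := ∃ y : A, x = star y * y

section Helpers

variable {A : Type*} [NormedRing A] [StarRing A] [CStarRing A]
  [NormedAlgebra ℂ A] [StarModule ℂ A]

/-- Apply a linear functional to the first leg of a tensor (`⟨φ, u₁⟩ u₂`). -/
def lapp (φ : A →ₗ[ℂ] ℂ) : A ⊗[ℂ] A →ₗ[ℂ] A :=
  (TensorProduct.lid ℂ A).toLinearMap ∘ₗ TensorProduct.map φ LinearMap.id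

/-- Apply a linear functional to the second leg of a tensor (`⟨φ, u₂⟩ u₁`). -/
def rapp (φ : A →ₗ[ℂ] ℂ) : A ⊗[ℂ] A →ₗ[ℂ] A :=
  (TensorProduct.rid ℂ A).toLinearMap ∘ₗ TensorProduct.map LinearMap.id φ

/-- Apply a pair of linear functionals to the two legs of a tensor (`⟨φ, u₁⟩⟨ψ, u₂⟩`). -/
def papp (φ ψ : A →ₗ[ℂ] ℂ) : A ⊗[ℂ] A →ₗ[ℂ] ℂ :=
  (TensorProduct.lid ℂ ℂ).toLinearMap ∘ₗ TensorProduct.map φ ψ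

end Helpers

/-- A `C*`-weak Hopf algebra: a finite-dimensional unital `C*`-algebra `A` equipped with a
comultiplication `Δ` (written in Sweedler notation `Δ x = x₍₁₎ ⊗ x₍₂₎`), counit `ε` and
antipode `S`, satisfying the axioms of Böhm–Szlachányi.  The field `starT` is the
(componentwise) star operation on `A ⊗[ℂ] A`, characterized by additivity and its values on
pure tensors. -/
structure WeakHopfData (A : Type*) [NormedRing A] [StarRing A] [CStarRing A]
    [NormedAlgebra ℂ A] [StarModule ℂ A] [FiniteDimensional ℂ A] : Type _ where
  Δ : A →ₗ[ℂ] A ⊗[ℂ] A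
  ε : A →ₗ[ℂ] ℂ
  S : A ≃ₗ[ℂ] A
  starT : A ⊗[ℂ] A → A ⊗[ℂ] A
  starT_add : ∀ u v : A ⊗[ℂ] A, starT (u + v) = starT u + starT v
  starT_tmul : ∀ a b : A, starT (a ⊗ₜ[ℂ] b) = star a ⊗ₜ[ℂ] star b
  /-- coassociativity of the comultiplication -/
  coassoc : (TensorProduct.assoc ℂ A A A).toLinearMap ∘ₗ
      (TensorProduct.map Δ LinearMap.id) ∘ₗ Δ = (TensorProduct.map LinearMap.id Δ) ∘ₗ Δ
  /-- counit axiom, left version -/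
  counit_left : (TensorProduct.lid ℂ A).toLinearMap ∘ₗ (TensorProduct.map ε LinearMap.id) ∘ₗ Δ
      = LinearMap.id
  /-- counit axiom, right version -/
  counit_right : (TensorProduct.rid ℂ A).toLinearMap ∘ₗ (TensorProduct.map LinearMap.id ε) ∘ₗ Δ
      = LinearMap.id
  /-- the comultiplication is multiplicative -/
  Δ_mul : ∀ x y : A, Δ (x * y) = Δ x * Δ y
  /-- the star operation is comultiplicative -/
  Δ_star : ∀ x : A, Δ (star x) = starT (Δ x)
  /-- the unit is weakly comultiplicative:
  `(Δ ⊗ id)(Δ 1) = (Δ 1 ⊗ 1)(1 ⊗ Δ 1)` -/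
  Δ_one_weak : (TensorProduct.map Δ LinearMap.id) (Δ 1)
      = (Δ 1 ⊗ₜ[ℂ] (1 : A)) * ((TensorProduct.assoc ℂ A A A).symm ((1 : A) ⊗ₜ[ℂ] Δ 1))
  /-- the unit is weakly comultiplicative:
  `(Δ ⊗ id)(Δ 1) = (1 ⊗ Δ 1)(Δ 1 ⊗ 1)` -/
  Δ_one_weak' : (TensorProduct.map Δ LinearMap.id) (Δ 1)
      = ((TensorProduct.assoc ℂ A A A).symm ((1 : A) ⊗ₜ[ℂ] Δ 1)) * (Δ 1 ⊗ₜ[ℂ] (1 : A))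
  /-- the counit is weakly multiplicative: `ε (x y z) = ε (x y₍₁₎) ε (y₍₂₎ z)` -/
  ε_weak : ∀ x y z : A,
      ε (x * y * z) = papp (ε ∘ₗ LinearMap.mulLeft ℂ x) (ε ∘ₗ LinearMap.mulRight ℂ z) (Δ y)
  /-- the counit is weakly multiplicative: `ε (x y z) = ε (x y₍₂₎) ε (y₍₁₎ z)` -/
  ε_weak' : ∀ x y z : A,
      ε (x * y * z) = papp (ε ∘ₗ LinearMap.mulRight ℂ z) (ε ∘ₗ LinearMap.mulLeft ℂ x) (Δ y)
  /-- antipode axiom: `x₍₁₎ S(x₍₂₎) = ε (1₍₁₎ x) 1₍₂₎` -/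
  antipode_left : ∀ x : A,
      LinearMap.mul' ℂ A ((TensorProduct.map LinearMap.id S.toLinearMap) (Δ x))
        = lapp (ε ∘ₗ LinearMap.mulRight ℂ x) (Δ 1)
  /-- antipode axiom: `S(x₍₁₎) x₍₂₎ = 1₍₁₎ ε (x 1₍₂₎)` -/
  antipode_right : ∀ x : A,
      LinearMap.mul' ℂ A ((TensorProduct.map S.toLinearMap LinearMap.id) (Δ x))
        = rapp (ε ∘ₗ LinearMap.mulLeft ℂ x) (Δ 1)
  /-- the antipode is antimultiplicative -/
  S_antimul : ∀ x y : A, S (x * y) = S y * S x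
  /-- the antipode is anticomultiplicative -/
  S_anticomul : ∀ x : A,
      Δ (S x) = (TensorProduct.comm ℂ A A) ((TensorProduct.map S.toLinearMap S.toLinearMap) (Δ x))

namespace WeakHopfData

variable {A : Type*} [NormedRing A] [StarRing A] [CStarRing A]
  [NormedAlgebra ℂ A] [StarModule ℂ A] [FiniteDimensional ℂ A]

/-- The source counital map `ε^L (x) = x₍₁₎ S(x₍₂₎)`. -/
def εL (W : WeakHopfData A) : A →ₗ[ℂ] A :=
  LinearMap.mul' ℂ A ∘ₗ TensorProduct.map LinearMap.id W.S.toLinearMap ∘ₗ W.Δ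

/-- The target counital map `ε^R (x) = S(x₍₁₎) x₍₂₎`. -/
def εR (W : WeakHopfData A) : A →ₗ[ℂ] A :=
  LinearMap.mul' ℂ A ∘ₗ TensorProduct.map W.S.toLinearMap LinearMap.id ∘ₗ W.Δ

/-- Full contraction of the iterated coproduct `Δ⁽ⁿ⁾ x = x₍₁₎ ⊗ ⋯ ⊗ x₍ₙ₊₁₎` against a family
of `n+1` linear functionals: `sweedlerEval W n φ x = ⟨φ 0, x₍₁₎⟩ ⋯ ⟨φ n, x₍ₙ₊₁₎⟩`.
Since linear functionals separate the points of a tensor power, identities between iterated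
coproducts are faithfully expressed through these contractions. -/
def sweedlerEval (W : WeakHopfData A) : (n : ℕ) → (Fin (n + 1) → (A →ₗ[ℂ] ℂ)) → (A →ₗ[ℂ] ℂ)
  | 0, φ => φ 0
  | n + 1, φ => papp (sweedlerEval W n (Fin.init φ)) (φ (Fin.last (n + 1))) ∘ₗ W.Δ

end WeakHopfData

/-- A `C*`-weak Hopf algebra together with its canonical distinguished elements:
the Haar integral `h`, the dual Haar integral `hHat`, the square roots `gL`, `gR` of
`E^L h`, `E^R h` (whence the canonical grouplike element `g = gL * gR⁻¹`), real powers
`gLpow`, `gRpow` of `gL` and `gR`, and a positive square root operation `sqrt`;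
all characterized by the (uniquely determining) properties listed as fields. -/
structure HaarPkg (A : Type*) [NormedRing A] [StarRing A] [CStarRing A]
    [NormedAlgebra ℂ A] [StarModule ℂ A] [FiniteDimensional ℂ A] : Type _ where
  W : WeakHopfData A
  /-- the Haar integral -/
  h : A
  haar_left : ∀ x : A, x * h = WeakHopfData.εL W x * h
  haar_right : ∀ x : A, h * x = h * WeakHopfData.εR W x
  haar_counitL : WeakHopfData.εL W h = 1
  haar_counitR : WeakHopfData.εR W h = 1
  haar_idem : h * h = h
  haar_star : star h = h
  haar_S : W.S h = h
  haar_nondeg : ∀ y : A, ∃ φ ψ : A →ₗ[ℂ] ℂ, lapp φ (W.Δ h) = y ∧ rapp ψ (W.Δ h) = y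
  /-- the Haar integral of the dual weak Hopf algebra `A*`, as a linear functional on `A` -/
  hHat : A →ₗ[ℂ] ℂ
  hHat_pos : ∀ x : A, ∃ r : ℝ, 0 ≤ r ∧ hHat (star x * x) = (r : ℂ)
  hHat_S : ∀ x : A, hHat (W.S x) = hHat x
  /-- `gL = (E^L h)^{1/2}` -/
  gL : A
  /-- `gR = (E^R h)^{1/2}` -/
  gR : A
  gL_pos : IsPosElem gL
  gR_pos : IsPosElem gR
  gL_unit : IsUnit gL
  gR_unit : IsUnit gR
  gL_sq : gL * gL = rapp hHat (W.Δ h)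
  gR_sq : gR * gR = lapp hHat (W.Δ h)
  gL_mem : gL ∈ Set.range (WeakHopfData.εL W)
  gR_mem : gR ∈ Set.range (WeakHopfData.εR W)
  gR_S : gR = W.S gL
  gLR_comm : gL * gR = gR * gL
  /-- the canonical grouplike element `g = gL * gR⁻¹` is positive -/
  g_pos : IsPosElem (gL * Ring.inverse gR)
  g_unit : IsUnit (gL * Ring.inverse gR)
  /-- `Δ g = (g ⊗ g) Δ 1` -/
  g_grouplike : W.Δ (gL * Ring.inverse gR)
      = ((gL * Ring.inverse gR) ⊗ₜ[ℂ] (gL * Ring.inverse gR)) * W.Δ 1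
  /-- `Δ g = Δ 1 (g ⊗ g)` -/
  g_grouplike' : W.Δ (gL * Ring.inverse gR)
      = W.Δ 1 * ((gL * Ring.inverse gR) ⊗ₜ[ℂ] (gL * Ring.inverse gR))
  /-- `S g = g⁻¹` -/
  g_S : W.S (gL * Ring.inverse gR) = Ring.inverse (gL * Ring.inverse gR)
  /-- `S² x = g x g⁻¹` -/
  S_sq : ∀ x : A,
      W.S (W.S x) = (gL * Ring.inverse gR) * x * Ring.inverse (gL * Ring.inverse gR)
  /-- `h₍₁₎ ⊗ g h₍₂₎ g = h₍₂₎ ⊗ h₍₁₎` -/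
  haar_flip : TensorProduct.map LinearMap.id
      (LinearMap.mulLeft ℂ (gL * Ring.inverse gR) ∘ₗ LinearMap.mulRight ℂ (gL * Ring.inverse gR))
      (W.Δ h) = (TensorProduct.comm ℂ A A) (W.Δ h)
  /-- dual integral relation `⟨ĥ, x (h gL⁻²)⟩ = ε x` -/
  hHat_dual₁ : ∀ x : A, hHat (x * (h * (Ring.inverse gL * Ring.inverse gL))) = W.ε x
  /-- dual integral relation `⟨ĥ, (gR⁻² h) x⟩ = ε x` -/
  hHat_dual₂ : ∀ x : A, hHat ((Ring.inverse gR * Ring.inverse gR * h) * x) = W.ε x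
  /-- dual integral relation `⟨ĥ, (h gL⁻²)₍₂₎⟩ (h gL⁻²)₍₁₎ = 1` -/
  hHat_dual₃ : rapp hHat (W.Δ (h * (Ring.inverse gL * Ring.inverse gL))) = 1
  /-- dual integral relation `⟨ĥ, (gR⁻² h)₍₁₎⟩ (gR⁻² h)₍₂₎ = 1` -/
  hHat_dual₄ : lapp hHat (W.Δ (Ring.inverse gR * Ring.inverse gR * h)) = 1
  /-- the positive square root, via the continuous functional calculus -/
  sqrt : A → A
  sqrt_pos : ∀ x : A, IsPosElem x → IsPosElem (sqrt x)
  sqrt_mul_self : ∀ x : A, IsPosElem x → sqrt x * sqrt x = x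
  /-- real powers of `gL`, via the continuous functional calculus -/
  gLpow : ℝ → A
  /-- real powers of `gR`, via the continuous functional calculus -/
  gRpow : ℝ → A
  gLpow_one : gLpow 1 = gL
  gRpow_one : gRpow 1 = gR
  gLpow_zero : gLpow 0 = 1
  gRpow_zero : gRpow 0 = 1
  gLpow_add : ∀ s t : ℝ, gLpow (s + t) = gLpow s * gLpow t
  gRpow_add : ∀ s t : ℝ, gRpow (s + t) = gRpow s * gRpow t
  gLpow_pos : ∀ t : ℝ, IsPosElem (gLpow t)
  gRpow_pos : ∀ t : ℝ, IsPosElem (gRpow t)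
  gLpow_continuous : Continuous gLpow
  gRpow_continuous : Continuous gRpow

namespace HaarPkg

variable {A : Type*} [NormedRing A] [StarRing A] [CStarRing A]
  [NormedAlgebra ℂ A] [StarModule ℂ A] [FiniteDimensional ℂ A]
variable (P : HaarPkg A)

/-- The canonical grouplike element `g = gL gR⁻¹`. -/
def g : A := P.gL * Ring.inverse P.gR

/-- The Watatani index `ı = ε^L (h gL⁻²)` of the Haar conditional expectations. -/
def iotaEl : A := WeakHopfData.εL P.W (P.h * (Ring.inverse P.gL * Ring.inverse P.gL))

/-- The element `ȷ = ⟨ĥ, (gL⁻²)₍₁₎⟩ (gL⁻²)₍₂₎`, the dual analogue of the Watatani index. -/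
def jayEl : A := lapp P.hHat (P.W.Δ (Ring.inverse P.gL * Ring.inverse P.gL))

/-- The pulling-through element `Ω = ı⁻¹ gL⁻¹ h gL⁻¹`. -/
def Ω : A := Ring.inverse P.iotaEl * Ring.inverse P.gL * P.h * Ring.inverse P.gL

/-- The map `J x = g^{-1/2} S(x) g^{1/2}`, as a linear map. -/
def Jlin : A →ₗ[ℂ] A :=
  LinearMap.mulRight ℂ (P.sqrt P.g) ∘ₗ
    LinearMap.mulLeft ℂ (Ring.inverse (P.sqrt P.g)) ∘ₗ P.W.S.toLinearMap

/-- The functional `⟨ω, x⟩ = ⟨ĥ, ȷ⁻¹ gL⁻¹ gR⁻¹ x⟩` (the dual analogue of `Ω`). -/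
def ω : A →ₗ[ℂ] ℂ :=
  P.hHat ∘ₗ LinearMap.mulLeft ℂ (Ring.inverse P.jayEl * (Ring.inverse P.gL * Ring.inverse P.gR))

/-- `ξ_L = ı^{1/2} ȷ^{1/2} gL`. -/
def ξL : A := P.sqrt P.iotaEl * P.sqrt P.jayEl * P.gL

/-- `ξ_R = ı^{1/2} ȷ^{1/2} gR`. -/
def ξR : A := P.sqrt P.iotaEl * P.sqrt P.jayEl * P.gR

/-- `ξ = ξ_L ξ_R`. -/
def ξ : A := P.ξL * P.ξR

/-- `J^L x = gL⁻¹ S(x) gL`. -/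
def JL : A → A := fun x => Ring.inverse P.gL * P.W.S x * P.gL

/-- `J^R x = gL S⁻¹(x) gL⁻¹`. -/
def JR : A → A := fun x => P.gL * P.W.S.symm x * Ring.inverse P.gL

end HaarPkg

section Contractions

variable {A : Type*} [NormedRing A] [NormedAlgebra ℂ A]

@[simp] theorem lapp_tmul (φ : A →ₗ[ℂ] ℂ) (a b : A) : lapp φ (a ⊗ₜ[ℂ] b) = φ a • b := by
  simp [lapp]

@[simp] theorem rapp_tmul (φ : A →ₗ[ℂ] ℂ) (a b : A) : rapp φ (a ⊗ₜ[ℂ] b) = φ b • a := by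
  simp [rapp]

@[simp] theorem papp_tmul (φ ψ : A →ₗ[ℂ] ℂ) (a b : A) :
    papp φ ψ (a ⊗ₜ[ℂ] b) = φ a * ψ b := by
  simp [papp]

theorem papp_eq_lapp (φ ψ : A →ₗ[ℂ] ℂ) (u : A ⊗[ℂ] A) : papp φ ψ u = ψ (lapp φ u) := by
  induction u using TensorProduct.induction_on with
  | zero => simp
  | tmul a b => simp
  | add u v hu hv => simp only [map_add, hu, hv]

theorem papp_eq_rapp (φ ψ : A →ₗ[ℂ] ℂ) (u : A ⊗[ℂ] A) : papp φ ψ u = φ (rapp ψ u) := by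
  induction u using TensorProduct.induction_on with
  | zero => simp
  | tmul a b => simp [mul_comm]
  | add u v hu hv => simp only [map_add, hu, hv]

theorem lapp_comp_mulRight (φ : A →ₗ[ℂ] ℂ) (z : A) (u : A ⊗[ℂ] A) :
    lapp (φ ∘ₗ LinearMap.mulRight ℂ z) u = lapp φ (u * (z ⊗ₜ[ℂ] 1)) := by
  induction u using TensorProduct.induction_on with
  | zero => simp
  | tmul a b => simp
  | add u v hu hv => simp only [map_add, add_mul, hu, hv]

theorem rapp_comp_mulRight (φ : A →ₗ[ℂ] ℂ) (z : A) (u : A ⊗[ℂ] A) :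
    rapp (φ ∘ₗ LinearMap.mulRight ℂ z) u = rapp φ (u * ((1 : A) ⊗ₜ[ℂ] z)) := by
  induction u using TensorProduct.induction_on with
  | zero => simp
  | tmul a b => simp
  | add u v hu hv => simp only [map_add, add_mul, hu, hv]

theorem rapp_mul_left (φ : A →ₗ[ℂ] ℂ) (x : A) (u : A ⊗[ℂ] A) :
    rapp φ ((x ⊗ₜ[ℂ] 1) * u) = x * rapp φ u := by
  induction u using TensorProduct.induction_on with
  | zero => simp
  | tmul a b => simp
  | add u v hu hv => simp only [map_add, mul_add, hu, hv]

theorem rapp_mul_right (φ : A →ₗ[ℂ] ℂ) (x : A) (u : A ⊗[ℂ] A) :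
    rapp φ (u * (x ⊗ₜ[ℂ] 1)) = rapp φ u * x := by
  induction u using TensorProduct.induction_on with
  | zero => simp
  | tmul a b => simp
  | add u v hu hv => simp only [map_add, add_mul, hu, hv]

theorem lapp_mul_right (φ : A →ₗ[ℂ] ℂ) (x : A) (u : A ⊗[ℂ] A) :
    lapp φ (u * ((1 : A) ⊗ₜ[ℂ] x)) = lapp φ u * x := by
  induction u using TensorProduct.induction_on with
  | zero => simp
  | tmul a b => simp
  | add u v hu hv => simp only [map_add, add_mul, hu, hv]

theorem lapp_comm (φ : A →ₗ[ℂ] ℂ) (x : A) (u : A ⊗[ℂ] A) :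
    lapp φ ((x ⊗ₜ[ℂ] 1) * TensorProduct.comm ℂ A A u) = rapp φ (((1 : A) ⊗ₜ[ℂ] x) * u) := by
  induction u using TensorProduct.induction_on with
  | zero => simp
  | tmul a b => simp
  | add u v hu hv => simp only [map_add, mul_add, hu, hv]

/-- Contracting the first leg of a threefold tensor commutes with a linear map on the
remaining legs, under the associator. -/
theorem map_lapp_of_assoc_eq (f : A →ₗ[ℂ] ℂ) (Δ : A →ₗ[ℂ] A ⊗[ℂ] A) (u : A ⊗[ℂ] A)
    (w : (A ⊗[ℂ] A) ⊗[ℂ] A)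
    (hw : TensorProduct.assoc ℂ A A A w = TensorProduct.map LinearMap.id Δ u) :
    TensorProduct.map (lapp f) LinearMap.id w = Δ (lapp f u) := by
  have key : TensorProduct.map (lapp f) LinearMap.id =
      ((TensorProduct.lid ℂ (A ⊗[ℂ] A)).toLinearMap ∘ₗ TensorProduct.map f LinearMap.id) ∘ₗ
        (TensorProduct.assoc ℂ A A A).toLinearMap := by
    ext a b c
    simp [TensorProduct.smul_tmul']
  rw [key, LinearMap.comp_apply, LinearEquiv.coe_coe, hw]
  clear hw key
  induction u using TensorProduct.induction_on with
  | zero => simp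
  | tmul a b => simp
  | add u v hu hv => simp only [map_add, hu, hv]

theorem map_lapp_mul (f : A →ₗ[ℂ] ℂ) (u v : A ⊗[ℂ] A) :
    TensorProduct.map (lapp f) LinearMap.id
      ((u ⊗ₜ[ℂ] (1 : A)) * (TensorProduct.assoc ℂ A A A).symm ((1 : A) ⊗ₜ[ℂ] v)) =
      (lapp f u ⊗ₜ[ℂ] 1) * v := by
  induction u using TensorProduct.induction_on with
  | zero => simp
  | add u u' hu hu' => simp only [TensorProduct.add_tmul, add_mul, map_add, hu, hu']
  | tmul a b =>
    induction v using TensorProduct.induction_on with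
    | zero => simp
    | tmul c d => simp
    | add v v' hv hv' => simp only [TensorProduct.tmul_add, mul_add, map_add, hv, hv']

theorem map_lapp_mul' (f : A →ₗ[ℂ] ℂ) (u v : A ⊗[ℂ] A) :
    TensorProduct.map (lapp f) LinearMap.id
      ((TensorProduct.assoc ℂ A A A).symm ((1 : A) ⊗ₜ[ℂ] v) * (u ⊗ₜ[ℂ] (1 : A))) =
      v * (lapp f u ⊗ₜ[ℂ] 1) := by
  induction u using TensorProduct.induction_on with
  | zero => simp
  | add u u' hu hu' => simp only [TensorProduct.add_tmul, mul_add, map_add, hu, hu']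
  | tmul a b =>
    induction v using TensorProduct.induction_on with
    | zero => simp
    | tmul c d => simp
    | add v v' hv hv' => simp only [TensorProduct.tmul_add, add_mul, map_add, hv, hv']

end Contractions

namespace WeakHopfData

variable {A : Type*} [NormedRing A] [StarRing A] [CStarRing A]
  [NormedAlgebra ℂ A] [StarModule ℂ A] [FiniteDimensional ℂ A] (W : WeakHopfData A)

theorem lapp_counit (x : A) : lapp W.ε (W.Δ x) = x :=
  LinearMap.congr_fun W.counit_left x

theorem rapp_counit (x : A) : rapp W.ε (W.Δ x) = x :=
  LinearMap.congr_fun W.counit_right x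

theorem Δ_one_mul (x : A) : W.Δ 1 * W.Δ x = W.Δ x := by rw [← W.Δ_mul, one_mul]

theorem Δ_mul_one (x : A) : W.Δ x * W.Δ 1 = W.Δ x := by rw [← W.Δ_mul, mul_one]

theorem S_one : W.S 1 = 1 := by
  obtain ⟨y, hy⟩ := W.S.surjective 1
  calc W.S 1 = W.S 1 * W.S y := by rw [hy, mul_one]
    _ = W.S y := by rw [← W.S_antimul, mul_one]
    _ = 1 := hy

theorem εL_apply (x : A) : W.εL x = lapp (W.ε ∘ₗ LinearMap.mulRight ℂ x) (W.Δ 1) :=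
  W.antipode_left x

theorem εR_one : W.εR 1 = 1 := by
  have hid : W.ε ∘ₗ LinearMap.mulLeft ℂ 1 = W.ε := by ext; simp
  have := W.antipode_right 1
  rw [hid, W.rapp_counit] at this
  exact this

/-- The linear map `a ⊗ b ↦ S b ⊗ S a`. -/
def flipS : A ⊗[ℂ] A →ₗ[ℂ] A ⊗[ℂ] A :=
  (TensorProduct.comm ℂ A A).toLinearMap ∘ₗ
    TensorProduct.map W.S.toLinearMap W.S.toLinearMap

@[simp] theorem flipS_tmul (a b : A) : W.flipS (a ⊗ₜ[ℂ] b) = W.S b ⊗ₜ[ℂ] W.S a := by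
  simp [flipS]

theorem Δ_S (x : A) : W.Δ (W.S x) = W.flipS (W.Δ x) := W.S_anticomul x

theorem flipS_mul (u v : A ⊗[ℂ] A) : W.flipS (u * v) = W.flipS v * W.flipS u := by
  induction u using TensorProduct.induction_on with
  | zero => simp
  | add u u' hu hu' => simp only [add_mul, mul_add, map_add, hu, hu']
  | tmul a b =>
    induction v using TensorProduct.induction_on with
    | zero => simp
    | tmul c d => simp [W.S_antimul]
    | add v v' hv hv' => simp only [mul_add, add_mul, map_add, hv, hv']

theorem ε_S (x : A) : W.ε (W.S x) = W.ε x := by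
  have h1 : ∀ u : A ⊗[ℂ] A,
      lapp W.ε (W.flipS u) = W.S (rapp (W.ε ∘ₗ W.S.toLinearMap) u) := by
    intro u
    induction u using TensorProduct.induction_on with
    | zero => simp
    | tmul a b => simp
    | add u v hu hv => simp only [map_add, hu, hv]
  have h2 : rapp (W.ε ∘ₗ W.S.toLinearMap) (W.Δ x) = x := by
    apply W.S.injective
    rw [← h1, ← W.Δ_S, W.lapp_counit]
  have h3 := papp_eq_rapp W.ε (W.ε ∘ₗ W.S.toLinearMap) (W.Δ x)
  rw [h2, papp_eq_lapp, W.lapp_counit] at h3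
  exact h3

theorem Δ_εL (x : A) : W.Δ (W.εL x) = (W.εL x ⊗ₜ[ℂ] 1) * W.Δ 1 := by
  rw [εL_apply, ← map_lapp_mul, ← W.Δ_one_weak]
  exact (map_lapp_of_assoc_eq _ _ _ _ (LinearMap.congr_fun W.coassoc 1)).symm

theorem Δ_εL' (x : A) : W.Δ (W.εL x) = W.Δ 1 * (W.εL x ⊗ₜ[ℂ] 1) := by
  rw [εL_apply, ← map_lapp_mul', ← W.Δ_one_weak']
  exact (map_lapp_of_assoc_eq _ _ _ _ (LinearMap.congr_fun W.coassoc 1)).symm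

theorem Δ_εL_mul (x y : A) : W.Δ (W.εL x * y) = (W.εL x ⊗ₜ[ℂ] 1) * W.Δ y := by
  rw [W.Δ_mul, W.Δ_εL, mul_assoc, W.Δ_one_mul]

theorem Δ_mul_εL (x y : A) : W.Δ (y * W.εL x) = W.Δ y * (W.εL x ⊗ₜ[ℂ] 1) := by
  rw [W.Δ_mul, W.Δ_εL', ← mul_assoc, W.Δ_mul_one]

theorem Δ_mul_S_εL (x y : A) :
    W.Δ (y * W.S (W.εL x)) = W.Δ y * ((1 : A) ⊗ₜ[ℂ] W.S (W.εL x)) := by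
  obtain ⟨y, rfl⟩ := W.S.surjective y
  rw [← W.S_antimul, W.Δ_S, W.Δ_εL_mul, W.flipS_mul, W.Δ_S, flipS_tmul, W.S_one]

/-- `x₍₁₎ ⊗ ε^L(x₍₂₎) = 1₍₁₎ x ⊗ 1₍₂₎`. -/
theorem map_id_εL (x : A) :
    TensorProduct.map LinearMap.id W.εL (W.Δ x) = W.Δ 1 * (x ⊗ₜ[ℂ] 1) := by
  have h1 : ∀ u v : A ⊗[ℂ] A, TensorProduct.map (rapp W.ε) LinearMap.id
      ((TensorProduct.assoc ℂ A A A).symm ((1 : A) ⊗ₜ[ℂ] v) * (u ⊗ₜ[ℂ] (1 : A))) =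
      TensorProduct.map LinearMap.id
        (lapp W.ε ∘ₗ LinearMap.mulLeft ℂ v ∘ₗ (TensorProduct.mk ℂ A A).flip 1) u := by
    intro u v
    induction u using TensorProduct.induction_on with
    | zero => simp
    | add u u' hu hu' => simp only [TensorProduct.add_tmul, mul_add, map_add, hu, hu']
    | tmul a b =>
      induction v using TensorProduct.induction_on with
      | zero => simp
      | tmul c d => simp [TensorProduct.smul_tmul']
      | add v v' hv hv' =>
        simp only [TensorProduct.tmul_add, add_mul, map_add, hv, hv']
        simp [add_mul, TensorProduct.tmul_add]
  have h2 : W.εL = lapp W.ε ∘ₗ LinearMap.mulLeft ℂ (W.Δ 1) ∘ₗ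
      (TensorProduct.mk ℂ A A).flip 1 := by
    ext y
    rw [εL_apply, lapp_comp_mulRight]
    rfl
  have h3 : ∀ u : A ⊗[ℂ] A, TensorProduct.map W.Δ LinearMap.id u * (W.Δ x ⊗ₜ[ℂ] (1 : A)) =
      TensorProduct.map W.Δ LinearMap.id (u * (x ⊗ₜ[ℂ] 1)) := by
    intro u
    induction u using TensorProduct.induction_on with
    | zero => simp
    | tmul a b => simp [W.Δ_mul]
    | add u v hu hv => simp only [map_add, add_mul, hu, hv]
  have h4 : ∀ u : A ⊗[ℂ] A, TensorProduct.map (rapp W.ε) LinearMap.id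
      (TensorProduct.map W.Δ LinearMap.id u) = u := by
    intro u
    induction u using TensorProduct.induction_on with
    | zero => simp
    | tmul a b => simp [W.rapp_counit]
    | add u v hu hv => simp only [map_add, hu, hv]
  have h5 : (W.Δ 1 ⊗ₜ[ℂ] (1 : A)) * (W.Δ x ⊗ₜ[ℂ] (1 : A)) = W.Δ x ⊗ₜ[ℂ] (1 : A) := by
    rw [Algebra.TensorProduct.tmul_mul_tmul, W.Δ_one_mul, one_mul]
  rw [h2, ← h1, ← h5, ← mul_assoc, ← W.Δ_one_weak', h3, h4]

theorem S_εL (x : A) : W.S (W.εL x) = W.εR (W.S x) := by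
  have key : ∀ u : A ⊗[ℂ] A,
      W.S (LinearMap.mul' ℂ A (TensorProduct.map LinearMap.id W.S.toLinearMap u)) =
      LinearMap.mul' ℂ A (TensorProduct.map W.S.toLinearMap LinearMap.id (W.flipS u)) := by
    intro u
    induction u using TensorProduct.induction_on with
    | zero => simp
    | tmul a b => simp [W.S_antimul]
    | add u v hu hv => simp only [map_add, hu, hv]
  simp only [εL, εR, LinearMap.comp_apply, key, Δ_S]

/-- `ε^R(x₍₁₎) ⊗ x₍₂₎ = 1₍₁₎ ⊗ x 1₍₂₎`. -/
theorem map_εR_id (x : A) :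
    TensorProduct.map W.εR LinearMap.id (W.Δ x) = ((1 : A) ⊗ₜ[ℂ] x) * W.Δ 1 := by
  obtain ⟨x, rfl⟩ := W.S.surjective x
  have key : ∀ u : A ⊗[ℂ] A, TensorProduct.map W.εR LinearMap.id (W.flipS u) =
      W.flipS (TensorProduct.map LinearMap.id W.εL u) := by
    intro u
    induction u using TensorProduct.induction_on with
    | zero => simp
    | tmul a b => simp [W.S_εL]
    | add u v hu hv => simp only [map_add, hu, hv]
  rw [W.Δ_S, key, W.map_id_εL, W.flipS_mul, flipS_tmul, ← W.Δ_S, W.S_one]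

theorem mul_map_S_mul (u : A ⊗[ℂ] A) (x : A) :
    LinearMap.mul' ℂ A (TensorProduct.map W.S.toLinearMap LinearMap.id (u * (x ⊗ₜ[ℂ] 1))) =
      W.S x * LinearMap.mul' ℂ A (TensorProduct.map W.S.toLinearMap LinearMap.id u) := by
  induction u using TensorProduct.induction_on with
  | zero => simp
  | tmul a b => simp [W.S_antimul, mul_assoc]
  | add u v hu hv => simp only [map_add, add_mul, mul_add, hu, hv]

/-- `S(x₍₁₎) ε^L(x₍₂₎) = S(x)`. -/
theorem mul_map_S_εL (x : A) :
    LinearMap.mul' ℂ A (TensorProduct.map W.S.toLinearMap W.εL (W.Δ x)) = W.S x := by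
  have h1 : TensorProduct.map W.S.toLinearMap W.εL =
      TensorProduct.map W.S.toLinearMap LinearMap.id ∘ₗ
        TensorProduct.map LinearMap.id W.εL := by
    rw [← TensorProduct.map_comp, LinearMap.comp_id, LinearMap.id_comp]
  rw [h1, LinearMap.comp_apply, W.map_id_εL, mul_map_S_mul]
  change W.S x * W.εR 1 = _
  rw [εR_one, mul_one]

theorem εR_εL (x : A) : W.εR (W.εL x) = W.S (W.εL x) := by
  change LinearMap.mul' ℂ A (TensorProduct.map W.S.toLinearMap LinearMap.id (W.Δ (W.εL x))) = _
  rw [W.Δ_εL', mul_map_S_mul]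
  change W.S (W.εL x) * W.εR 1 = _
  rw [εR_one, mul_one]

theorem εL_mul_of_Δ_eq {z : A} (hz : W.Δ z = (z ⊗ₜ[ℂ] 1) * W.Δ 1) (x : A) :
    W.εL (z * x) = z * W.εL x := by
  have key : ∀ u : A ⊗[ℂ] A,
      LinearMap.mul' ℂ A (TensorProduct.map LinearMap.id W.S.toLinearMap ((z ⊗ₜ[ℂ] 1) * u)) =
      z * LinearMap.mul' ℂ A (TensorProduct.map LinearMap.id W.S.toLinearMap u) := by
    intro u
    induction u using TensorProduct.induction_on with
    | zero => simp
    | tmul a b => simp [mul_assoc]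
    | add u v hu hv => simp only [map_add, mul_add, hu, hv]
  simp only [εL, LinearMap.comp_apply]
  rw [W.Δ_mul, hz, mul_assoc, W.Δ_one_mul, key]

/-- A left integral `l` satisfies `l₍₁₎ ⊗ x l₍₂₎ = S(x) l₍₁₎ ⊗ l₍₂₎`. -/
theorem tmul_mul_Δ_integral {l : A} (hl : ∀ x, x * l = W.εL x * l) (x : A) :
    ((1 : A) ⊗ₜ[ℂ] x) * W.Δ l = (W.S x ⊗ₜ[ℂ] 1) * W.Δ l := by
  let F : A ⊗[ℂ] (A ⊗[ℂ] A) →ₗ[ℂ] A ⊗[ℂ] A :=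
    LinearMap.mulRight ℂ (W.Δ l) ∘ₗ LinearMap.mul' ℂ (A ⊗[ℂ] A) ∘ₗ
      TensorProduct.map ((TensorProduct.mk ℂ A A).flip 1 ∘ₗ W.S.toLinearMap) LinearMap.id
  have h1 : ∀ u : A ⊗[ℂ] A, F (TensorProduct.map LinearMap.id W.Δ u) =
      (LinearMap.mul' ℂ A (TensorProduct.map W.S.toLinearMap W.εL u) ⊗ₜ[ℂ] 1) * W.Δ l := by
    intro u
    induction u using TensorProduct.induction_on with
    | zero => simp
    | tmul a b =>
      simp only [F, TensorProduct.map_tmul, LinearMap.comp_apply, LinearMap.mul'_apply,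
        LinearMap.mulRight_apply, LinearMap.id_apply, LinearMap.flip_apply,
        TensorProduct.mk_apply, LinearEquiv.coe_coe]
      rw [mul_assoc, ← W.Δ_mul, hl, W.Δ_εL_mul, ← mul_assoc,
        Algebra.TensorProduct.tmul_mul_tmul, one_mul]
    | add u v hu hv => simp only [map_add, TensorProduct.add_tmul, add_mul, hu, hv]
  have h2 : ∀ (u : A ⊗[ℂ] A) (c : A), F (TensorProduct.assoc ℂ A A A (u ⊗ₜ[ℂ] c)) =
      (LinearMap.mul' ℂ A (TensorProduct.map W.S.toLinearMap LinearMap.id u) ⊗ₜ[ℂ] c) *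
        W.Δ l := by
    intro u c
    induction u using TensorProduct.induction_on with
    | zero => simp
    | tmul a b => simp [F]
    | add u v hu hv => simp only [map_add, TensorProduct.add_tmul, add_mul, hu, hv]
  have h3 : ∀ u : A ⊗[ℂ] A,
      F (TensorProduct.assoc ℂ A A A (TensorProduct.map W.Δ LinearMap.id u)) =
      TensorProduct.map W.εR LinearMap.id u * W.Δ l := by
    intro u
    induction u using TensorProduct.induction_on with
    | zero => simp
    | tmul a b => rw [TensorProduct.map_tmul, h2]; rfl
    | add u v hu hv => simp only [map_add, add_mul, hu, hv]
  have h4 := h3 (W.Δ x)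
  have h5 : TensorProduct.assoc ℂ A A A (TensorProduct.map W.Δ LinearMap.id (W.Δ x)) =
      TensorProduct.map LinearMap.id W.Δ (W.Δ x) := LinearMap.congr_fun W.coassoc x
  rw [h5, h1, mul_map_S_εL, map_εR_id, mul_assoc, W.Δ_one_mul] at h4
  exact h4.symm

/-- An `S`-invariant left integral `l` satisfies `l₍₁₎ x ⊗ l₍₂₎ = l₍₁₎ ⊗ l₍₂₎ S(x)`. -/
theorem Δ_integral_mul_tmul {l : A} (hl : ∀ x, x * l = W.εL x * l) (hS : W.S l = l) (x : A) :
    W.Δ l * (x ⊗ₜ[ℂ] 1) = W.Δ l * ((1 : A) ⊗ₜ[ℂ] W.S x) := by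
  obtain ⟨x, rfl⟩ := W.S.surjective x
  have h1 := congrArg W.flipS (W.tmul_mul_Δ_integral hl x)
  rwa [flipS_mul, flipS_mul, flipS_tmul, flipS_tmul, ← Δ_S, hS, S_one] at h1

/-- If `k₍₁₎ ⊗ x k₍₂₎ = S(x) k₍₁₎ ⊗ k₍₂₎` for all `x`, then `ε^L(k)` is central. -/
theorem εL_central {k : A}
    (hk : ∀ x, ((1 : A) ⊗ₜ[ℂ] x) * W.Δ k = (W.S x ⊗ₜ[ℂ] 1) * W.Δ k) (x : A) :
    x * W.εL k = W.εL k * x := by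
  obtain ⟨x, rfl⟩ := W.S.surjective x
  have h1 : ∀ u : A ⊗[ℂ] A, LinearMap.mul' ℂ A
      (TensorProduct.map LinearMap.id W.S.toLinearMap ((W.S x ⊗ₜ[ℂ] 1) * u)) =
      W.S x * LinearMap.mul' ℂ A (TensorProduct.map LinearMap.id W.S.toLinearMap u) := by
    intro u
    induction u using TensorProduct.induction_on with
    | zero => simp
    | tmul a b => simp [mul_assoc]
    | add u v hu hv => simp only [map_add, mul_add, hu, hv]
  have h2 : ∀ u : A ⊗[ℂ] A, LinearMap.mul' ℂ A
      (TensorProduct.map LinearMap.id W.S.toLinearMap (((1 : A) ⊗ₜ[ℂ] x) * u)) =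
      LinearMap.mul' ℂ A (TensorProduct.map LinearMap.id W.S.toLinearMap u) * W.S x := by
    intro u
    induction u using TensorProduct.induction_on with
    | zero => simp
    | tmul a b => simp [W.S_antimul, mul_assoc]
    | add u v hu hv => simp only [map_add, mul_add, add_mul, hu, hv]
  simp only [εL, LinearMap.comp_apply]
  rw [← h1, ← hk, h2]

end WeakHopfData

theorem IsPosElem.star_eq {A : Type*} [Mul A] [StarMul A] {x : A} (hx : IsPosElem x) :
    star x = x := by
  obtain ⟨y, rfl⟩ := hx
  rw [star_mul, star_star]

theorem IsPosElem.ringInverse {A : Type*} [Ring A] [StarRing A] {x : A} (hx : IsPosElem x)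
    (hu : IsUnit x) : IsPosElem (Ring.inverse x) := by
  have hs : star (Ring.inverse x) = Ring.inverse x := by
    rw [← Ring.inverse_star, hx.star_eq]
  obtain ⟨y, hy⟩ := hx
  refine ⟨y * Ring.inverse x, ?_⟩
  rw [star_mul, hs, mul_assoc, ← mul_assoc (star y), ← hy, Ring.mul_inverse_cancel _ hu, mul_one]

theorem IsPosElem.mul_of_commute {A : Type*} [NormedRing A] [StarRing A] [CStarRing A]
    [NormedAlgebra ℂ A] [StarModule ℂ A] [FiniteDimensional ℂ A] {x y : A}
    (hx : IsPosElem x) (hy : IsPosElem y) (hxy : Commute x y) : IsPosElem (x * y) := by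
  have hc : CompleteSpace A := FiniteDimensional.complete ℂ A
  let : CStarAlgebra A := { }
  let := CStarAlgebra.spectralOrder A
  have := CStarAlgebra.spectralOrderedRing A
  have h1 : ∀ z : A, IsPosElem z ↔ 0 ≤ z := fun z =>
    CStarAlgebra.nonneg_iff_eq_star_mul_self.symm
  rw [h1] at *
  exact hxy.mul_nonneg hx hy

namespace HaarPkg

variable {A : Type*} [NormedRing A] [StarRing A] [CStarRing A]
  [NormedAlgebra ℂ A] [StarModule ℂ A] [FiniteDimensional ℂ A] (P : HaarPkg A)

local notation "γL" => Ring.inverse P.gL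
local notation "γR" => Ring.inverse P.gR

theorem gL_mul_inv : P.gL * γL = 1 := Ring.mul_inverse_cancel _ P.gL_unit
theorem inv_mul_gL : γL * P.gL = 1 := Ring.inverse_mul_cancel _ P.gL_unit
theorem gR_mul_inv : P.gR * γR = 1 := Ring.mul_inverse_cancel _ P.gR_unit
theorem inv_mul_gR : γR * P.gR = 1 := Ring.inverse_mul_cancel _ P.gR_unit

theorem commute_gL_gR : Commute P.gL P.gR := P.gLR_comm

theorem commute_inv_gL_gR : Commute γL P.gR := by
  obtain ⟨u, hu⟩ := P.gL_unit
  have := P.commute_gL_gR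
  rw [← hu] at this ⊢
  rw [Ring.inverse_unit]
  exact this.units_inv_left

theorem commute_gL_inv_gR : Commute P.gL γR := by
  obtain ⟨u, hu⟩ := P.gR_unit
  have := P.commute_gL_gR
  rw [← hu] at this ⊢
  rw [Ring.inverse_unit]
  exact this.units_inv_right

theorem commute_inv_gL_inv_gR : Commute γL γR := by
  obtain ⟨u, hu⟩ := P.gR_unit
  have := P.commute_inv_gL_gR
  rw [← hu] at this ⊢
  rw [Ring.inverse_unit]
  exact this.units_inv_right

theorem S_gL : P.W.S P.gL = P.gR := P.gR_S.symm

theorem S_inv_gL : P.W.S γL = γR := by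
  have h1 : P.W.S γL * P.gR = 1 := by
    rw [← P.S_gL, ← P.W.S_antimul, P.gL_mul_inv, P.W.S_one]
  calc P.W.S γL = P.W.S γL * (P.gR * γR) := by rw [P.gR_mul_inv, mul_one]
    _ = γR := by rw [← mul_assoc, h1, one_mul]

theorem inverse_g : Ring.inverse (P.gL * γR) = P.gR * γL := by
  have h1 : P.gL * γR * (P.gR * γL) = 1 := by
    rw [mul_assoc, ← mul_assoc γR, P.inv_mul_gR, one_mul, P.gL_mul_inv]
  calc Ring.inverse (P.gL * γR)
      = Ring.inverse (P.gL * γR) * (P.gL * γR * (P.gR * γL)) := by rw [h1, mul_one]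
    _ = P.gR * γL := by
      rw [← mul_assoc (Ring.inverse _), Ring.inverse_mul_cancel _ P.g_unit, one_mul]

theorem S_gR : P.W.S P.gR = P.gL := by
  rw [← P.S_gL, P.S_sq, P.inverse_g]
  calc P.gL * γR * P.gL * (P.gR * γL) = P.gL * (γR * P.gL) * P.gR * γL := by noncomm_ring
    _ = P.gL * P.gL * (γR * P.gR) * γL := by rw [← P.commute_gL_inv_gR.eq]; noncomm_ring
    _ = P.gL := by rw [P.inv_mul_gR, mul_one, mul_assoc, P.gL_mul_inv, mul_one]

theorem S_inv_gR : P.W.S γR = γL := by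
  have h1 : P.W.S γR * P.gL = 1 := by
    rw [← P.S_gR, ← P.W.S_antimul, P.gR_mul_inv, P.W.S_one]
  calc P.W.S γR = P.W.S γR * (P.gL * γL) := by rw [P.gL_mul_inv, mul_one]
    _ = γL := by rw [← mul_assoc, h1, one_mul]

theorem haar_mul_gL : P.h * P.gL = P.h * P.gR := by
  obtain ⟨z, hz⟩ := P.gL_mem
  rw [P.haar_right P.gL, ← P.S_gL, ← hz, P.W.εR_εL]

theorem Δ_mul_inv_gL (y : A) : P.W.Δ (y * γL) = P.W.Δ y * (γL ⊗ₜ[ℂ] 1) := by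
  obtain ⟨z, hz⟩ := P.gL_mem
  have h1 := P.W.Δ_mul_εL z (y * γL)
  rw [hz, mul_assoc, P.inv_mul_gL, mul_one] at h1
  rw [h1, mul_assoc, Algebra.TensorProduct.tmul_mul_tmul, P.gL_mul_inv, mul_one,
    ← Algebra.TensorProduct.one_def, mul_one]

/-- `⟨ĥ, x h₍₂₎⟩ h₍₁₎ = S(x) gL²`. -/
theorem rapp_hHat_mul_haar (x : A) :
    rapp P.hHat (((1 : A) ⊗ₜ[ℂ] x) * P.W.Δ P.h) = P.W.S x * (P.gL * P.gL) := by
  have h1 := P.hHat_dual₃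
  rw [← mul_assoc, P.Δ_mul_inv_gL, P.Δ_mul_inv_gL, rapp_mul_right, rapp_mul_right] at h1
  have h2 : rapp P.hHat (P.W.Δ P.h) = P.gL * P.gL := P.gL_sq.symm
  rw [P.W.tmul_mul_Δ_integral P.haar_left, rapp_mul_left, h2]

/-- `⟨ĥ, h₍₁₎ x⟩ h₍₂₎ = gR² S(x)`. -/
theorem lapp_hHat_haar_mul (x : A) :
    lapp P.hHat (P.W.Δ P.h * (x ⊗ₜ[ℂ] 1)) = P.gR * P.gR * P.W.S x := by
  rw [P.W.Δ_integral_mul_tmul P.haar_left P.haar_S, lapp_mul_right, P.gR_sq]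

/-- `⟨ĥ, x h₍₁₎⟩ h₍₂₎ = g⁻¹ S(x) gL² g⁻¹`. -/
theorem lapp_hHat_mul_haar (x : A) :
    lapp P.hHat ((x ⊗ₜ[ℂ] 1) * P.W.Δ P.h) =
      P.gR * γL * (P.W.S x * (P.gL * P.gL)) * (P.gR * γL) := by
  have h1 : ∀ u : A ⊗[ℂ] A, lapp P.hHat ((x ⊗ₜ[ℂ] 1) * TensorProduct.map LinearMap.id
      (LinearMap.mulLeft ℂ (P.gL * γR) ∘ₗ LinearMap.mulRight ℂ (P.gL * γR)) u) =
      P.gL * γR * lapp P.hHat ((x ⊗ₜ[ℂ] 1) * u) * (P.gL * γR) := by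
    intro u
    induction u using TensorProduct.induction_on with
    | zero => simp
    | tmul c d => simp [mul_assoc]
    | add u v hu hv => simp only [map_add, mul_add, add_mul, hu, hv]
  have h2 := h1 (P.W.Δ P.h)
  rw [P.haar_flip, lapp_comm, P.rapp_hHat_mul_haar] at h2
  rw [h2, ← P.inverse_g]
  have h3 := Ring.inverse_mul_cancel _ P.g_unit
  have h4 := Ring.mul_inverse_cancel _ P.g_unit
  rw [mul_assoc _ _ (P.gL * γR), ← mul_assoc (Ring.inverse _), h3, one_mul, mul_assoc, h4, mul_one]

/-- The modular automorphism of `ĥ` is implemented by `gL gR`. -/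
theorem hHat_mul (y x : A) :
    P.hHat (y * x) = P.hHat (γL * γR * x * (P.gL * P.gR) * y) := by
  have h1 : ∀ ψ : A →ₗ[ℂ] ℂ, ∀ u : A ⊗[ℂ] A,
      P.hHat (rapp ψ u * x) = ψ (lapp P.hHat (u * (x ⊗ₜ[ℂ] 1))) := by
    intro ψ u
    rw [← rapp_mul_right, ← papp_eq_rapp, papp_eq_lapp]
  have h2 : ∀ ψ : A →ₗ[ℂ] ℂ, ∀ u : A ⊗[ℂ] A, ∀ z : A,
      P.hHat (z * rapp ψ u) = ψ (lapp P.hHat ((z ⊗ₜ[ℂ] 1) * u)) := by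
    intro ψ u z
    rw [← rapp_mul_left, ← papp_eq_rapp, papp_eq_lapp]
  obtain ⟨_, ψ, -, rfl⟩ := P.haar_nondeg y
  rw [h1, h2, lapp_hHat_haar_mul, lapp_hHat_mul_haar]
  congr 1
  simp only [P.W.S_antimul, P.S_inv_gR, P.S_inv_gL, P.S_gL, P.S_gR]
  have e1 : P.gR * γL * (P.gL * P.gR) = P.gR * P.gR := by
    rw [mul_assoc, ← mul_assoc γL, P.inv_mul_gL, one_mul]
  have e2 : γL * γR * (P.gL * P.gL) * (P.gR * γL) = 1 := by
    calc γL * γR * (P.gL * P.gL) * (P.gR * γL)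
        = γL * (γR * P.gL) * (P.gL * P.gR) * γL := by noncomm_ring
      _ = (γL * P.gL) * (γR * P.gR) * (P.gL * γL) := by
        rw [← P.commute_gL_inv_gR.eq, P.gLR_comm]; noncomm_ring
      _ = 1 := by rw [P.inv_mul_gL, P.inv_mul_gR, P.gL_mul_inv, one_mul, one_mul]
  calc P.gR * P.gR * P.W.S x
      = P.gR * γL * (P.gL * P.gR) * P.W.S x *
          (γL * γR * (P.gL * P.gL) * (P.gR * γL)) := by rw [e1, e2, mul_one]
    _ = _ := by noncomm_ring

/-- The left integral `h gL⁻²`. -/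
def dualIntegral : A := P.h * (γL * γL)

theorem Δ_dualIntegral :
    P.W.Δ P.dualIntegral = P.W.Δ P.h * ((γL * γL) ⊗ₜ[ℂ] 1) := by
  rw [dualIntegral, ← mul_assoc, Δ_mul_inv_gL, Δ_mul_inv_gL, mul_assoc,
    Algebra.TensorProduct.tmul_mul_tmul, one_mul]

theorem mul_iotaEl (x : A) : x * P.iotaEl = P.iotaEl * x := by
  refine P.W.εL_central (k := P.dualIntegral) (fun x => ?_) x
  rw [Δ_dualIntegral, ← mul_assoc, P.W.tmul_mul_Δ_integral P.haar_left, mul_assoc]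

theorem S_iotaEl : P.W.S P.iotaEl = P.iotaEl := by
  let N : A ⊗[ℂ] A →ₗ[ℂ] A := LinearMap.mul' ℂ A ∘ₗ TensorProduct.map
    (LinearMap.mulLeft ℂ (P.gL * γR) ∘ₗ LinearMap.mulRight ℂ (P.gR * γL * (γR * γR)))
    P.W.S.toLinearMap
  let m : A ⊗[ℂ] A →ₗ[ℂ] A :=
    LinearMap.mul' ℂ A ∘ₗ TensorProduct.map LinearMap.id P.W.S.toLinearMap
  have h1 : ∀ u : A ⊗[ℂ] A, P.W.S (m (u * ((γL * γL) ⊗ₜ[ℂ] 1))) =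
      N (TensorProduct.comm ℂ A A u) := by
    intro u
    induction u using TensorProduct.induction_on with
    | zero => simp
    | tmul p q => simp [N, m, P.W.S_antimul, P.S_inv_gL, P.S_sq, P.inverse_g, mul_assoc]
    | add u v hu hv => simp only [map_add, add_mul, hu, hv]
  have e1 : P.gR * γL * (γR * γR) * (P.gR * γL) = γL * γL := by
    calc P.gR * γL * (γR * γR) * (P.gR * γL)
        = P.gR * (γL * γR) * (γR * P.gR) * γL := by noncomm_ring
      _ = (P.gR * γR) * γL * (γR * P.gR) * γL := by
        rw [P.commute_inv_gL_inv_gR.eq]; noncomm_ring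
      _ = γL * γL := by rw [P.gR_mul_inv, P.inv_mul_gR, one_mul, mul_one]
  have h2 : ∀ u : A ⊗[ℂ] A, N (TensorProduct.map LinearMap.id
      (LinearMap.mulLeft ℂ (P.gL * γR) ∘ₗ LinearMap.mulRight ℂ (P.gL * γR)) u) =
      P.gL * γR * m (u * ((γL * γL) ⊗ₜ[ℂ] 1)) * (P.gR * γL) := by
    intro u
    induction u using TensorProduct.induction_on with
    | zero => simp
    | tmul p q =>
      simp only [N, m, TensorProduct.map_tmul, LinearMap.comp_apply, LinearMap.id_apply,
        LinearMap.mulLeft_apply, LinearMap.mulRight_apply, LinearMap.mul'_apply,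
        LinearEquiv.coe_coe, Algebra.TensorProduct.tmul_mul_tmul, mul_one]
      rw [P.W.S_antimul (P.gL * γR), P.W.S_antimul q, P.g_S, P.inverse_g, ← e1]
      noncomm_ring
    | add u v hu hv => simp only [map_add, mul_add, add_mul, hu, hv]
  have h3 : P.iotaEl = m (P.W.Δ P.h * ((γL * γL) ⊗ₜ[ℂ] 1)) := by
    rw [← Δ_dualIntegral]; rfl
  have h4 := h1 (P.W.Δ P.h)
  rw [← P.haar_flip, h2, ← h3, P.mul_iotaEl] at h4
  rw [h4, mul_assoc, mul_assoc P.gL, ← mul_assoc γR, P.inv_mul_gR, one_mul, P.gL_mul_inv,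
    mul_one]

theorem Δ_mul_iotaEl (x : A) : P.W.Δ (x * P.iotaEl) = P.W.Δ x * (P.iotaEl ⊗ₜ[ℂ] 1) :=
  P.W.Δ_mul_εL _ x

theorem Δ_mul_iotaEl' (x : A) :
    P.W.Δ (x * P.iotaEl) = P.W.Δ x * ((1 : A) ⊗ₜ[ℂ] P.iotaEl) := by
  have h1 := P.W.Δ_mul_S_εL (P.h * (γL * γL)) x
  change P.W.Δ (x * P.W.S P.iotaEl) = _ * (1 ⊗ₜ[ℂ] P.W.S P.iotaEl) at h1
  rwa [P.S_iotaEl] at h1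

theorem lapp_ε_iotaEl (x : A) :
    lapp (P.W.ε ∘ₗ LinearMap.mulRight ℂ P.iotaEl) (P.W.Δ x) = x * P.iotaEl := by
  rw [lapp_comp_mulRight, ← Δ_mul_iotaEl, P.W.lapp_counit]

theorem rapp_ε_iotaEl (x : A) :
    rapp (P.W.ε ∘ₗ LinearMap.mulRight ℂ P.iotaEl) (P.W.Δ x) = x * P.iotaEl := by
  rw [rapp_comp_mulRight, ← Δ_mul_iotaEl', P.W.rapp_counit]

/-- `(h gL⁻²)² = ı h gL⁻²`. -/
theorem dualIntegral_mul_self :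
    P.dualIntegral * P.dualIntegral = P.iotaEl * P.dualIntegral := by
  conv_lhs => rw [dualIntegral, ← mul_assoc, P.haar_left, mul_assoc]
  rfl

theorem star_inv_gL : star γL = γL := (P.gL_pos.ringInverse P.gL_unit).star_eq

theorem eq_zero_of_mul_haar_eq_zero {z : A} (hz : P.W.Δ z = (z ⊗ₜ[ℂ] 1) * P.W.Δ 1)
    (h0 : z * P.h = 0) : z = 0 := by
  have := P.W.εL_mul_of_Δ_eq hz P.h
  rwa [h0, map_zero, P.haar_counitL, mul_one, eq_comm] at this

theorem mul_haar_eq_zero_of_mul_iotaEl_eq_zero {z : A} (hz : z * P.iotaEl = 0) :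
    z * P.h = 0 := by
  have h1 : z * (P.dualIntegral * P.dualIntegral) = 0 := by
    rw [dualIntegral_mul_self, ← mul_assoc, hz, zero_mul]
  have h2 : z * P.h * γL * star (z * P.h * γL) = 0 := by
    have e : z * P.h * γL * star (z * P.h * γL) =
        z * (P.dualIntegral * P.dualIntegral) * (P.gL * P.gL) * star z := by
      have e2 : γL * γL * (P.gL * P.gL) = 1 := by
        rw [mul_assoc, ← mul_assoc γL P.gL, P.inv_mul_gL, one_mul, P.inv_mul_gL]
      calc z * P.h * γL * star (z * P.h * γL)
          = z * P.h * (γL * γL) * P.h * star z := by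
            rw [star_mul, star_mul, P.star_inv_gL, P.haar_star]; noncomm_ring
        _ = z * P.h * (γL * γL) * P.h * (γL * γL * (P.gL * P.gL)) * star z := by
            rw [e2, mul_one]
        _ = _ := by rw [dualIntegral]; noncomm_ring
    rw [e, h1, zero_mul, zero_mul]
  have h3 : z * P.h * γL = 0 := (CStarRing.mul_star_self_eq_zero_iff _).1 h2
  calc z * P.h = z * P.h * γL * P.gL := by rw [mul_assoc, P.inv_mul_gL, mul_one]
    _ = 0 := by rw [h3, zero_mul]

theorem isUnit_iotaEl : IsUnit P.iotaEl := by
  let L : Submodule ℂ A := LinearMap.ker (P.W.Δ -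
    LinearMap.mulRight ℂ (P.W.Δ 1) ∘ₗ (TensorProduct.mk ℂ A A).flip 1)
  have hL : ∀ z, z ∈ L ↔ P.W.Δ z = (z ⊗ₜ[ℂ] 1) * P.W.Δ 1 := by
    intro z
    simp [L, sub_eq_zero]
  have hmul : ∀ z ∈ L, LinearMap.mulRight ℂ P.iotaEl z ∈ L := by
    intro z hz
    rw [hL] at hz ⊢
    have h1 : P.W.Δ P.iotaEl = (P.iotaEl ⊗ₜ[ℂ] 1) * P.W.Δ 1 := P.W.Δ_εL _
    rw [LinearMap.mulRight_apply, P.W.Δ_mul, hz, mul_assoc, P.W.Δ_one_mul, h1, ← mul_assoc,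
      Algebra.TensorProduct.tmul_mul_tmul, mul_one]
  have hinj : Function.Injective ((LinearMap.mulRight ℂ P.iotaEl).restrict hmul) := by
    rw [injective_iff_map_eq_zero]
    rintro ⟨z, hz⟩ h0
    have h1 : z * P.iotaEl = 0 := congrArg Subtype.val h0
    exact Subtype.ext (P.eq_zero_of_mul_haar_eq_zero ((hL z).1 hz)
      (P.mul_haar_eq_zero_of_mul_iotaEl_eq_zero h1))
  have hone : (1 : A) ∈ L := by
    rw [hL, ← Algebra.TensorProduct.one_def, one_mul]
  obtain ⟨⟨w, _⟩, hw⟩ := LinearMap.injective_iff_surjective.1 hinj ⟨1, hone⟩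
  have h1 : w * P.iotaEl = 1 := congrArg Subtype.val hw
  exact ⟨⟨P.iotaEl, w, by rw [← P.mul_iotaEl, h1], h1⟩, rfl⟩

/-- `ε(x ı) = ⟨ĥ, gL⁻¹ gR⁻¹ gL⁻¹ h x h gL⁻¹⟩`. -/
theorem ε_mul_iotaEl (x : A) :
    P.W.ε (x * P.iotaEl) = P.hHat (γL * γR * (γL * P.h * x * (P.h * γL))) := by
  have h1 : P.h * γL * P.gR = P.h := by
    rw [mul_assoc, P.commute_inv_gL_gR.eq, ← mul_assoc, ← P.haar_mul_gL, mul_assoc,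
      P.gL_mul_inv, mul_one]
  have h2 : P.h * (γL * γL) * (P.gL * P.gR) = P.h := by
    calc P.h * (γL * γL) * (P.gL * P.gR) = P.h * γL * (γL * P.gL) * P.gR := by noncomm_ring
      _ = P.h := by rw [P.inv_mul_gL, mul_one, h1]
  rw [← P.hHat_dual₁, mul_assoc, ← dualIntegral, ← P.dualIntegral_mul_self]
  have h3 : x * (P.dualIntegral * P.dualIntegral) =
      x * (P.h * γL) * (γL * (P.h * (γL * γL))) := by
    rw [dualIntegral]; noncomm_ring
  rw [h3, P.hHat_mul]
  congr 1
  calc γL * γR * (γL * (P.h * (γL * γL))) * (P.gL * P.gR) * (x * (P.h * γL))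
      = γL * γR * γL * (P.h * (γL * γL) * (P.gL * P.gR)) * x * (P.h * γL) := by noncomm_ring
    _ = _ := by rw [h2]; noncomm_ring

theorem hHat_inv_mul_nonneg (x : A) :
    ∃ r : ℝ, 0 ≤ r ∧ P.hHat (γL * γR * (star x * x)) = (r : ℂ) := by
  have hpos : IsPosElem (γL * γR) :=
    (P.gL_pos.ringInverse P.gL_unit).mul_of_commute (P.gR_pos.ringInverse P.gR_unit)
      P.commute_inv_gL_inv_gR
  have hD : γL * γR * (P.gL * P.gR) = 1 := by
    rw [mul_assoc, ← mul_assoc γR, ← P.commute_gL_inv_gR.eq, mul_assoc P.gL, P.inv_mul_gR,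
      mul_one, P.inv_mul_gL]
  obtain ⟨c, hc, hcc⟩ : ∃ c : A, star c = c ∧ c * c = γL * γR :=
    ⟨_, (P.sqrt_pos _ hpos).star_eq, P.sqrt_mul_self _ hpos⟩
  have hcomm : γL * γR * c = c * (γL * γR) := by rw [← hcc, mul_assoc]
  obtain ⟨r, hr, h⟩ := P.hHat_pos (x * c)
  refine ⟨r, hr, ?_⟩
  rw [← h, star_mul, hc]
  have h1 : c * star x * (x * c) = c * star x * x * c := by noncomm_ring
  rw [h1, P.hHat_mul (c * star x * x), hcomm, mul_assoc c, hD, mul_one, ← hcc]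
  congr 1
  noncomm_ring

end HaarPkg

/-- **Properties of the dual Watatani index `ĵ`.**
With `ı = ε^L (h gL⁻²)` and `⟨ĵ, x⟩ := ε (x ı)`, the functional `ĵ` satisfies:
(1) `⟨ĵ, x⟩ = ε (ı x)`; (2) `ı = ⟨ĵ, 1₍₁₎⟩ 1₍₂₎ = ⟨ĵ, 1₍₂₎⟩ 1₍₁₎`; (3) `ĵ ∘ S = ĵ`;
(4) `ĵ` is a positive functional; (5) `ĵ` is central for the convolution product of `A*`;
(6) `ĵ` is convolution-invertible with inverse `x ↦ ε (x ı⁻¹)`. -/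
theorem HaarPkg.jHat_properties {A : Type*} [NormedRing A] [StarRing A] [CStarRing A]
    [NormedAlgebra ℂ A] [StarModule ℂ A] [FiniteDimensional ℂ A]
    (P : HaarPkg A) (jHat : A →ₗ[ℂ] ℂ)
    (hjHat : jHat = P.W.ε ∘ₗ LinearMap.mulRight ℂ P.iotaEl) :
    (∀ x : A, jHat x = P.W.ε (P.iotaEl * x)) ∧
    (P.iotaEl = lapp jHat (P.W.Δ 1) ∧ P.iotaEl = rapp jHat (P.W.Δ 1)) ∧
    (∀ x : A, jHat (P.W.S x) = jHat x) ∧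
    (∀ x : A, ∃ r : ℝ, 0 ≤ r ∧ jHat (star x * x) = (r : ℂ)) ∧
    (∀ (φ : A →ₗ[ℂ] ℂ) (x : A), papp jHat φ (P.W.Δ x) = papp φ jHat (P.W.Δ x)) ∧
    (∀ x : A,
      papp jHat (P.W.ε ∘ₗ LinearMap.mulRight ℂ (Ring.inverse P.iotaEl)) (P.W.Δ x)
        = P.W.ε x ∧
      papp (P.W.ε ∘ₗ LinearMap.mulRight ℂ (Ring.inverse P.iotaEl)) jHat (P.W.Δ x)
        = P.W.ε x) := by
  subst hjHat
  refine ⟨fun x => ?_, ⟨?_, ?_⟩, fun x => ?_, fun x => ?_, fun φ x => ?_, fun x => ⟨?_, ?_⟩⟩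
  · rw [LinearMap.comp_apply, LinearMap.mulRight_apply, P.mul_iotaEl]
  · rw [P.lapp_ε_iotaEl, one_mul]
  · rw [P.rapp_ε_iotaEl, one_mul]
  · have h1 : P.W.S x * P.iotaEl = P.W.S (x * P.iotaEl) := by
      rw [P.W.S_antimul, P.S_iotaEl, P.mul_iotaEl]
    rw [LinearMap.comp_apply, LinearMap.mulRight_apply, h1, P.W.ε_S]
    rfl
  · obtain ⟨r, hr, h⟩ := P.hHat_inv_mul_nonneg (x * (P.h * Ring.inverse P.gL))
    refine ⟨r, hr, ?_⟩
    rw [← h, LinearMap.comp_apply, LinearMap.mulRight_apply, P.ε_mul_iotaEl, star_mul, star_mul,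
      P.star_inv_gL, P.haar_star]
    congr 1
    noncomm_ring
  · rw [papp_eq_lapp, papp_eq_rapp, P.lapp_ε_iotaEl, P.rapp_ε_iotaEl]
  · rw [papp_eq_lapp, P.lapp_ε_iotaEl, LinearMap.comp_apply, LinearMap.mulRight_apply, mul_assoc,
      Ring.mul_inverse_cancel _ P.isUnit_iotaEl, mul_one]
  · rw [papp_eq_rapp, P.rapp_ε_iotaEl, LinearMap.comp_apply, LinearMap.mulRight_apply, mul_assoc,
      Ring.mul_inverse_cancel _ P.isUnit_iotaEl, mul_one]

end
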